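/- Let T be a triangulated category with arbitrary small coproducts, P a compact generator of T, and suppose Λ is N-sparse and gl dim Λ < N. Fix i ∈ ℤ/N and let E_i denote the full subcategory of T consisting of objects X with π_*X ∈ B[i]. Then π_* restricts to an equivalence of categories from E_i onto the full subcategory of graded right Λ-modules concentrated in degrees congruent to i modulo N; in particular, for all X, Y ∈ E_i the map π_*: Hom_T(X, Y) → Hom_Λ(π_*X, π_*Y) is bijective, and every graded right Λ-module in B[i] is isomorphic to π_*X for some X ∈ E_i. -/

import Mathlib

/-!
Shared setup: a triangulated category `C` with (co)products, a compact generator `P`,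
the graded endomorphism ring `Λ = End_T(P)_* = Hom_T(Σ^* P, P)` and its category of
graded right modules, realized concretely.
-/

set_option linter.unusedSectionVars false

open CategoryTheory CategoryTheory.Limits CategoryTheory.Pretriangulated DirectSum

universe v u

namespace Franke

variable {C : Type u} [Category.{v} C] [Preadditive C] [HasZeroObject C]
  [HasShift C ℤ] [∀ n : ℤ, (shiftFunctor C n).Additive] [Pretriangulated C]

/-- The degree `k` component of the graded endomorphism ring
`Λ = End_T(P)_* = Hom_T(Σ^* P, P)`: its degree `k` part is `Hom(P⟦k⟧, P)`. -/
abbrev lam (P : C) (k : ℤ) : Type v := (P⟦k⟧ ⟶ P)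

/-- The right action of a degree `k` element `a : Σᵏ P ⟶ P` of `Λ` on a degree `n`
element `m : Σⁿ P ⟶ X` of the graded hom `π_* X = Hom_T(Σ^* P, X)`; the result is the
degree `n + k` element `Σ^{n+k} P ≅ (Σᵏ P)⟦n⟧ → Σⁿ P → X`. -/
def gsmulHom (P : C) {X : C} {n k l : ℤ} (h : n + k = l)
    (m : P⟦n⟧ ⟶ X) (a : lam P k) : P⟦l⟧ ⟶ X :=
  (shiftFunctorAdd' C k n l (by omega)).hom.app P ≫ a⟦n⟧' ≫ m

/-- The multiplication of the graded endomorphism ring `Λ = End_T(P)_*`. -/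
def gmul (P : C) {j k l : ℤ} (h : j + k = l) (a : lam P j) (b : lam P k) : lam P l :=
  gsmulHom P h a b

/-- The unit `1 ∈ Λ₀ = Hom(Σ⁰P, P)` of the graded endomorphism ring. -/
def gone (P : C) : lam P 0 := (shiftFunctorZero C ℤ).hom.app P

/-- A ℤ-graded right module over the graded endomorphism ring `Λ = End_T(P)_*`.
The action is indexed by proofs `n + k = l` in order to avoid transport along
equalities of degrees. -/
structure GradedModule (P : C) where
  M : ℤ → Type v
  [acg : ∀ n, AddCommGroup (M n)]
  smul : ∀ {n k l : ℤ}, n + k = l → M n → lam P k → M l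
  smul_addₓ : ∀ {n k l : ℤ} (h : n + k = l) (m : M n) (a b : lam P k),
    smul h m (a + b) = smul h m a + smul h m b
  add_smulₓ : ∀ {n k l : ℤ} (h : n + k = l) (m m' : M n) (a : lam P k),
    smul h (m + m') a = smul h m a + smul h m' a
  smul_oneₓ : ∀ {n : ℤ} (m : M n), smul (add_zero n) m (gone P) = m
  smul_mulₓ : ∀ {n j k nj jk njk : ℤ} (h₁ : n + j = nj) (h₂ : j + k = jk)
    (h₃ : nj + k = njk) (h₄ : n + jk = njk) (m : M n) (a : lam P j) (b : lam P k),
    smul h₃ (smul h₁ m a) b = smul h₄ m (gmul P h₂ a b)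

attribute [instance] GradedModule.acg

/-- The action of a fixed `a : Λₖ` as an additive map `Mₙ →+ M_{n+k}`. -/
def GradedModule.smulAddHom {P : C} (M : GradedModule P) {n k l : ℤ} (h : n + k = l)
    (a : lam P k) : M.M n →+ M.M l :=
  AddMonoidHom.mk' (fun m => M.smul h m a) (fun m m' => M.add_smulₓ h m m' a)

theorem GradedModule.zero_smulₓ {P : C} (M : GradedModule P) {n k l : ℤ} (h : n + k = l)
    (a : lam P k) : M.smul h (0 : M.M n) a = 0 :=
  map_zero (M.smulAddHom h a)

/-- `π_* X = Hom_T(Σ^* P, X)` as a graded right `Λ`-module. -/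
@[reducible] def piMod (P X : C) : GradedModule P where
  M n := P⟦n⟧ ⟶ X
  smul h m a := gsmulHom P h m a
  smul_addₓ h m a b := by
    simp [gsmulHom, Functor.map_add, Preadditive.comp_add, Preadditive.add_comp]
  add_smulₓ h m m' a := by
    simp [gsmulHom, Preadditive.comp_add]
  smul_oneₓ m := by
    simp only [gsmulHom, gone]
    rw [shiftFunctorAdd'_zero_add_hom_app, ← Functor.map_comp_assoc, Iso.inv_hom_id_app]
    simp
  smul_mulₓ {n j k nj jk njk} h₁ h₂ h₃ h₄ m a b := by
    simp only [gsmulHom, gmul, Functor.map_comp, Category.assoc]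
    have nat := ((shiftFunctorAdd' C j n nj (by omega)).hom).naturality b
    dsimp at nat
    rw [reassoc_of% nat]
    rw [← shiftFunctorAdd'_assoc_hom_app_assoc k j n jk nj njk (by omega) (by omega)
      (by omega) P]


/-- A morphism of graded right `Λ`-modules: a degree-preserving `Λ`-linear additive map. -/
structure GHom {P : C} (M N : GradedModule P) where
  app : ∀ n : ℤ, M.M n →+ N.M n
  app_smul : ∀ {n k l : ℤ} (h : n + k = l) (m : M.M n) (a : lam P k),
    app l (M.smul h m a) = N.smul h (app n m) a

@[ext] theorem GHom.ext {P : C} {M N : GradedModule P} {f g : GHom M N}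
    (h : ∀ (n : ℤ) (x : M.M n), f.app n x = g.app n x) : f = g := by
  obtain ⟨fa, _⟩ := f; obtain ⟨ga, _⟩ := g
  congr 1
  funext n
  exact AddMonoidHom.ext (h n)

/-- The identity morphism of graded modules. -/
def GHom.id {P : C} (M : GradedModule P) : GHom M M :=
  ⟨fun _ => AddMonoidHom.id _, fun _ _ _ => rfl⟩

/-- Composition of morphisms of graded modules. -/
def GHom.comp {P : C} {M N K : GradedModule P} (g : GHom N K) (f : GHom M N) : GHom M K :=
  ⟨fun n => (g.app n).comp (f.app n), fun h m a => by
    simp only [AddMonoidHom.comp_apply, f.app_smul, g.app_smul]⟩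

instance {P : C} {M N : GradedModule P} : Zero (GHom M N) :=
  ⟨{ app := fun _ => 0
     app_smul := fun h m a => by
       show (0 : N.M _) = N.smul h (0 : N.M _) a
       exact (N.zero_smulₓ h a).symm }⟩

@[simp] theorem GHom.zero_app {P : C} {M N : GradedModule P} (n : ℤ) (x : M.M n) :
    (0 : GHom M N).app n x = 0 := rfl

/-- An isomorphism of graded right `Λ`-modules. -/
structure GIso {P : C} (M N : GradedModule P) where
  hom : GHom M N
  inv : GHom N M
  hom_inv_id : inv.comp hom = GHom.id M
  inv_hom_id : hom.comp inv = GHom.id N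

/-- The shift `M[k]` of a graded module, with `M[k]ₙ = M_{n-k}`. -/
@[reducible] def gshift {P : C} (k : ℤ) (M : GradedModule P) : GradedModule P where
  M n := M.M (n - k)
  smul h m a := M.smul (by omega) m a
  smul_addₓ h m a b := M.smul_addₓ _ m a b
  add_smulₓ h m m' a := M.add_smulₓ _ m m' a
  smul_oneₓ m := M.smul_oneₓ m
  smul_mulₓ h₁ h₂ h₃ h₄ m a b := M.smul_mulₓ _ h₂ _ _ m a b

/-- Surjectivity (in each degree) of a morphism of graded modules. -/
def GHom.Surj {P : C} {M N : GradedModule P} (f : GHom M N) : Prop :=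
  ∀ n : ℤ, Function.Surjective (f.app n)

/-- A pair of composable morphisms of graded modules `0 → Z → E → B → 0`
forming a short exact sequence. -/
structure IsShortExact {P : C} {Z E B : GradedModule P} (ι : GHom Z E) (ρ : GHom E B) : Prop where
  mono : ∀ n : ℤ, Function.Injective (ι.app n)
  epi : ∀ n : ℤ, Function.Surjective (ρ.app n)
  exact : ∀ (n : ℤ) (x : E.M n), ρ.app n x = 0 ↔ x ∈ Set.range (ι.app n)

/-- Exactness of `M → N → K` at `N` (including that the composite vanishes). -/
def ExactPair {P : C} {M N K : GradedModule P} (f : GHom M N) (g : GHom N K) : Prop :=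
  ∀ (n : ℤ) (x : N.M n), g.app n x = 0 ↔ x ∈ Set.range (f.app n)

/-- A graded module is projective if every degreewise surjection onto it splits against
any map from it: the usual lifting property. -/
def IsProjective {P : C} (Q : GradedModule P) : Prop :=
  ∀ (A B : GradedModule P) (e : GHom A B), e.Surj →
    ∀ f : GHom Q B, ∃ g : GHom Q A, e.comp g = f

/-- `projDimLE d M` says that the graded module `M` admits a projective resolution of
length at most `d`, i.e. has projective dimension `≤ d`. -/
def projDimLE {P : C} : ℕ → GradedModule P → Prop
  | 0, M => IsProjective M
  | d + 1, M => ∃ (F K : GradedModule P) (ε : GHom F M) (ι : GHom K F),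
      IsProjective F ∧ IsShortExact ι ε ∧ projDimLE d K

/-- `Λ = End_T(P)_*` is `N`-sparse: concentrated in degrees divisible by `N`. -/
def Sparse (P : C) (N : ℕ) : Prop :=
  ∀ k : ℤ, ¬ ((N : ℤ) ∣ k) → ∀ a : lam P k, a = 0

/-- A graded module belongs to `B[i]`: it is concentrated in degrees congruent
to `i` modulo `N`. -/
def InDegrees {P : C} (N : ℕ) (i : ZMod N) (M : GradedModule P) : Prop :=
  ∀ n : ℤ, (n : ZMod N) ≠ i → ∀ x : M.M n, x = 0

/-- The canonical comparison map `⊕ᵢ Hom(P, Xᵢ) → Hom(P, ∐ᵢ Xᵢ)`. -/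
noncomputable def compactComparison [HasCoproducts.{v} C] (P : C) {ι : Type v} (X : ι → C) :
    (⨁ i, (P ⟶ X i)) →+ (P ⟶ ∐ X) := by
  classical
  exact DirectSum.toAddMonoid fun i =>
    AddMonoidHom.mk' (fun f => f ≫ Sigma.ι X i) (fun f g => Preadditive.add_comp _ _ _ _ _ _)

/-- `P` is a compact object: `Hom(P, −)` commutes with small coproducts. -/
def IsCompactObj [HasCoproducts.{v} C] (P : C) : Prop :=
  ∀ (ι : Type v) (X : ι → C), Function.Bijective (compactComparison P X)

/-- `P` is a generator: an object all of whose graded homs from `P` vanish is zero. -/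
def IsGenerator (P : C) : Prop :=
  ∀ X : C, (∀ (n : ℤ) (f : P⟦n⟧ ⟶ X), f = 0) → IsZero X

/-- The morphism of graded modules `π_* f : π_* X → π_* Y` induced by `f : X ⟶ Y`. -/
def piGHom (P : C) {X Y : C} (f : X ⟶ Y) : GHom (piMod P X) (piMod P Y) where
  app n := AddMonoidHom.mk' (fun u => u ≫ f) fun u v => Preadditive.add_comp _ _ _ _ _ _
  app_smul h m a := by
    show (gsmulHom P h m a) ≫ f = gsmulHom P h (m ≫ f) a
    simp [gsmulHom]

/-- An extension of `B` by `Z` in the category of graded right `Λ`-modules: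
  a short exact sequence `0 → Z → E → B → 0`. -/
structure GExtension {P : C} (B Z : GradedModule P) where
  E : GradedModule P
  ι : GHom Z E
  ρ : GHom E B
  shortExact : IsShortExact ι ρ

/-- Two extensions are identified if there is a morphism of extensions between them
(such a morphism is automatically an isomorphism). -/
def GExtension.Rel {P : C} {B Z : GradedModule P} (e e' : GExtension B Z) : Prop :=
  ∃ φ : GHom e.E e'.E, φ.comp e.ι = e'.ι ∧ e'.ρ.comp φ = e.ρ

/-- `Ext¹_Λ(B, Z)`, realized as the set of equivalence classes of extensions
`0 → Z → E → B → 0` of graded right `Λ`-modules. -/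
def Ext1 {P : C} (B Z : GradedModule P) : Type _ :=
  Quot (GExtension.Rel (B := B) (Z := Z))

/-- Given `δ : Cc ⟶ ΣX`, the induced morphism of graded modules
`π_* Cc → (π_* X)[1]`, using the canonical identification `π_*(ΣX) ≅ (π_*X)[1]`. -/
noncomputable def triangleConnect (P : C) {X Cc : C} (δ : Cc ⟶ X⟦(1:ℤ)⟧) :
    GHom (piMod P Cc) (gshift 1 (piMod P X)) where
  app n := AddMonoidHom.mk' (fun u =>
    (shiftFunctorAdd' C n (-1) (n-1) (by omega)).hom.app P ≫ (u ≫ δ)⟦(-1:ℤ)⟧' ≫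
      (shiftFunctorCompIsoId C (1:ℤ) (-1) (by omega)).hom.app X) (fun u v => by
        simp [Preadditive.add_comp, Preadditive.comp_add, Functor.map_add])
  app_smul {n k l} h m a := by
    simp only [AddMonoidHom.mk'_apply]
    show (shiftFunctorAdd' C l (-1) (l-1) (by omega)).hom.app P ≫
        ((gsmulHom P h m a) ≫ δ)⟦(-1:ℤ)⟧' ≫
          (shiftFunctorCompIsoId C (1:ℤ) (-1) (by omega)).hom.app X =
      gsmulHom P (show (n-1) + k = l - 1 by omega)
        ((shiftFunctorAdd' C n (-1) (n-1) (by omega)).hom.app P ≫ (m ≫ δ)⟦(-1:ℤ)⟧' ≫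
          (shiftFunctorCompIsoId C (1:ℤ) (-1) (by omega)).hom.app X) a
    simp only [gsmulHom, Functor.map_comp, Category.assoc]
    have nat := ((shiftFunctorAdd' C n (-1) (n-1) (by omega : n + -1 = n - 1)).hom).naturality a
    dsimp at nat
    rw [reassoc_of% nat]
    rw [shiftFunctorAdd'_assoc_hom_app_assoc k n (-1) l (n-1) (l-1) (by omega) (by omega)
      (by omega) P]

section ExtGroups

instance {P : C} {M N : GradedModule P} : Add (GHom M N) :=
  ⟨fun f g =>
    { app := fun n => f.app n + g.app n
      app_smul := fun {n k l} h m a => by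
        show f.app l _ + g.app l _ = N.smul h (f.app n m + g.app n m) a
        rw [f.app_smul, g.app_smul, N.add_smulₓ] }⟩

instance {P : C} {M N : GradedModule P} : Neg (GHom M N) :=
  ⟨fun f =>
    { app := fun n => -(f.app n)
      app_smul := fun {n k l} h m a => by
        show -(f.app l _) = N.smul h (-(f.app n m)) a
        rw [f.app_smul]
        exact (map_neg (N.smulAddHom h a) _).symm }⟩

@[simp] theorem GHom.add_app {P : C} {M N : GradedModule P} (f g : GHom M N) (n : ℤ)
    (x : M.M n) : (f + g).app n x = f.app n x + g.app n x := rfl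

@[simp] theorem GHom.neg_app {P : C} {M N : GradedModule P} (f : GHom M N) (n : ℤ)
    (x : M.M n) : (-f).app n x = -(f.app n x) := rfl

instance {P : C} {M N : GradedModule P} : AddCommGroup (GHom M N) where
  add := (· + ·)
  zero := 0
  neg := Neg.neg
  add_assoc f g h := by ext n x; simp [add_assoc]
  zero_add f := by ext n x; simp
  add_zero f := by ext n x; simp
  add_comm f g := by ext n x; simp [add_comm]
  neg_add_cancel f := by ext n x; simp
  nsmul := nsmulRec
  zsmul := zsmulRec

/-- A projective resolution `⋯ → F₂ → F₁ → F₀ → B → 0` of a graded right `Λ`-module. -/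
structure ProjResolution {P : C} (B : GradedModule P) where
  F : ℕ → GradedModule P
  d : ∀ i : ℕ, GHom (F (i + 1)) (F i)
  aug : GHom (F 0) B
  projective : ∀ i, IsProjective (F i)
  aug_surjective : ∀ n : ℤ, Function.Surjective (aug.app n)
  exact_aug : ∀ (n : ℤ) (x : (F 0).M n), aug.app n x = 0 ↔ x ∈ Set.range ((d 0).app n)
  exact_d : ∀ (i : ℕ) (n : ℤ) (x : (F (i + 1)).M n),
    (d i).app n x = 0 ↔ x ∈ Set.range ((d (i + 1)).app n)

/-- The differential of the cochain complex `Hom_Λ(F_•, Z)` obtained by applying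
`Hom_Λ(−, Z)` to a projective resolution `F_•`. -/
def cochainD {P : C} {B : GradedModule P} (R : ProjResolution B) (Z : GradedModule P)
    (i : ℕ) : GHom (R.F i) Z →+ GHom (R.F (i + 1)) Z :=
  AddMonoidHom.mk' (fun f => f.comp (R.d i)) (fun f g => by ext n x; rfl)

/-- `Ext^{j+1}_Λ(B, Z)`, computed as the `(j+1)`-st cohomology
`ker(Hom(F_{j+1}, Z) → Hom(F_{j+2}, Z)) / im(Hom(F_j, Z) → Hom(F_{j+1}, Z))`
of the complex `Hom_Λ(F_•, Z)` for a projective resolution `F_• → B`. -/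
def extGroup {P : C} {B : GradedModule P} (R : ProjResolution B) (Z : GradedModule P)
    (j : ℕ) : Type v :=
  AddMonoidHom.ker (cochainD R Z (j + 1)) ⧸
    (AddMonoidHom.range (cochainD R Z j)).addSubgroupOf
      (AddMonoidHom.ker (cochainD R Z (j + 1)))

noncomputable instance {P : C} {B : GradedModule P} (R : ProjResolution B)
    (Z : GradedModule P) (j : ℕ) : AddCommGroup (extGroup R Z j) := by
  dsimp [extGroup]; infer_instance

end ExtGroups
section DG

/-- A differential graded right module over `Λ = End_T(P)_*`, where `Λ` is regarded as a
DG ring with zero differential: a graded right `Λ`-module together with a square-zero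
`Λ`-linear differential of degree `-1`. -/
structure DGMod (P : C) where
  gm : GradedModule P
  d : ∀ {n m : ℤ}, m + 1 = n → (gm.M n →+ gm.M m)
  d_sq : ∀ {n m j : ℤ} (h : m + 1 = n) (h' : j + 1 = m) (x : gm.M n), d h' (d h x) = 0
  d_smul : ∀ {n m j l l' : ℤ} (h : m + 1 = n) (hl : n + j = l) (hl' : l' + 1 = l)
    (hm : m + j = l') (x : gm.M n) (a : lam P j),
    d hl' (gm.smul hl x a) = gm.smul hm (d h x) a

/-- A morphism of DG `Λ`-modules: a morphism of the underlying graded modules commuting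
with the differentials. -/
structure DGHom {P : C} (M N : DGMod P) where
  g : GHom M.gm N.gm
  comm : ∀ {n m : ℤ} (h : m + 1 = n) (x : M.gm.M n),
    g.app m (M.d h x) = N.d h (g.app n x)

@[ext] theorem DGHom.ext {P : C} {M N : DGMod P} {f f' : DGHom M N}
    (h : ∀ (n : ℤ) (x : M.gm.M n), f.g.app n x = f'.g.app n x) : f = f' := by
  obtain ⟨fg, _⟩ := f; obtain ⟨fg', _⟩ := f'
  congr 1
  exact GHom.ext h

/-- The category of differential graded right `Λ`-modules. -/
instance dgModCategory (P : C) : Category (DGMod P) where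
  Hom M N := DGHom M N
  id M := ⟨GHom.id _, fun _ _ => rfl⟩
  comp f g := ⟨g.g.comp f.g, fun h x => by
    show g.g.app _ (f.g.app _ _) = _
    rw [f.comm, g.comm]
    rfl⟩
  id_comp f := by apply DGHom.ext; intros; rfl
  comp_id f := by apply DGHom.ext; intros; rfl
  assoc f g h := by apply DGHom.ext; intros; rfl

/-- The cycles `ker dₙ` of a DG module in degree `n`. -/
abbrev cycles {P : C} (M : DGMod P) (n : ℤ) : AddSubgroup (M.gm.M n) :=
  AddMonoidHom.ker (M.d (n := n) (m := n - 1) (by omega))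

/-- The boundaries `im d_{n+1}` of a DG module in degree `n`. -/
abbrev boundaries {P : C} (M : DGMod P) (n : ℤ) : AddSubgroup (M.gm.M n) :=
  AddMonoidHom.range (M.d (n := n + 1) (m := n) rfl)

/-- The homology `H_n M = ker dₙ / im d_{n+1}` of a DG module. -/
abbrev dgHomology {P : C} (M : DGMod P) (n : ℤ) : Type v :=
  cycles M n ⧸ (boundaries M n).addSubgroupOf (cycles M n)

/-- The map induced on cycles by a morphism of DG modules. -/
def cyclesMap {P : C} {M N : DGMod P} (f : M ⟶ N) (n : ℤ) : cycles M n →+ cycles N n :=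
  AddMonoidHom.codRestrict ((f.g.app n).comp (cycles M n).subtype) _ (fun x => by
    have hx : M.d (show (n - 1) + 1 = n by omega) x.1 = 0 := x.2
    have : N.d (show (n - 1) + 1 = n by omega) (f.g.app n x.1) = 0 := by
      rw [← f.comm (show (n - 1) + 1 = n by omega), hx, map_zero]
    exact this)

/-- The map induced on homology by a morphism of DG modules. -/
def dgHomologyMap {P : C} {M N : DGMod P} (f : M ⟶ N) (n : ℤ) :
    dgHomology M n →+ dgHomology N n :=
  QuotientAddGroup.map _ _ (cyclesMap f n) (by
    intro x hx
    have hx' : x.1 ∈ boundaries M n := hx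
    obtain ⟨y, hy⟩ := AddMonoidHom.mem_range.mp hx'
    have : (f.g.app n x.1) ∈ boundaries N n := by
      refine AddMonoidHom.mem_range.mpr ⟨f.g.app (n + 1) y, ?_⟩
      rw [← f.comm rfl y, hy]
    exact this)

/-- A quasi-isomorphism of DG modules: a morphism inducing an isomorphism on homology. -/
def quasiIso (P : C) : MorphismProperty (DGMod P) :=
  fun _ _ f => ∀ n : ℤ, Function.Bijective (dgHomologyMap f n)

/-- The derived category `D(Λ)` of the graded endomorphism ring `Λ = End_T(P)_*`
(regarded as a DG ring with zero differential): the localization of the category of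
DG right `Λ`-modules at the quasi-isomorphisms. -/
abbrev DerivedCat (P : C) := (quasiIso P).Localization

end DG


section GradedModules

variable {P : C}

@[simp] theorem GHom.comp_app {M N K : GradedModule P} (g : GHom N K) (f : GHom M N) (n : ℤ)
    (x : M.M n) : (g.comp f).app n x = g.app n (f.app n x) := rfl

@[simp] theorem GHom.id_app (M : GradedModule P) (n : ℤ) (x : M.M n) :
    (GHom.id M).app n x = x := rfl

@[simp] theorem piGHom_app {X Y : C} (f : X ⟶ Y) (n : ℤ) (x : P⟦n⟧ ⟶ X) :
    (piGHom P f).app n x = x ≫ f := rfl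

theorem GHom.congr_app {M N : GradedModule P} {f g : GHom M N} (h : f = g) (n : ℤ) (x : M.M n) :
    f.app n x = g.app n x := by rw [h]

theorem GradedModule.smul_zeroₓ (M : GradedModule P) {n k l : ℤ} (h : n + k = l) (m : M.M n) :
    M.smul h m 0 = 0 := by
  have := M.smul_addₓ h m 0 0
  simpa using this

theorem GIso.inv_hom_app {M N : GradedModule P} (e : GIso M N) (n : ℤ) (x : M.M n) :
    e.inv.app n (e.hom.app n x) = x :=
  GHom.congr_app e.hom_inv_id n x

theorem GIso.hom_inv_app {M N : GradedModule P} (e : GIso M N) (n : ℤ) (x : N.M n) :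
    e.hom.app n (e.inv.app n x) = x :=
  GHom.congr_app e.inv_hom_id n x

/-- The inverse of an isomorphism of graded modules. -/
def GIso.symm {M N : GradedModule P} (e : GIso M N) : GIso N M :=
  ⟨e.inv, e.hom, e.inv_hom_id, e.hom_inv_id⟩

theorem InDegrees.of_injective {N : ℕ} {i : ZMod N} {A B : GradedModule P} (hB : InDegrees N i B)
    (f : GHom A B) (hf : ∀ n, Function.Injective (f.app n)) : InDegrees N i A := fun n hn x =>
  hf n (by rw [map_zero]; exact hB n hn _)

theorem InDegrees.of_iso {N : ℕ} {i : ZMod N} {A B : GradedModule P} (hA : InDegrees N i A)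
    (e : GIso A B) : InDegrees N i B :=
  hA.of_injective e.inv fun n => Function.LeftInverse.injective (e.hom_inv_app n)

/-- A morphism of graded modules descends along a surjection whose kernel it kills. -/
theorem GHom.exists_desc {A B D : GradedModule P} (e : GHom A B) (he : e.Surj) (f : GHom A D)
    (h : ∀ n x, e.app n x = 0 → f.app n x = 0) : ∃ g : GHom B D, g.comp e = f := by
  have key : ∀ n x y, e.app n x = e.app n y → f.app n x = f.app n y := fun n x y hxy => by
    rw [← sub_eq_zero, ← map_sub]
    exact h n _ (by rw [map_sub, hxy, sub_self])
  have hs : ∀ n y, e.app n ((he n y).choose) = y := fun n y => (he n y).choose_spec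
  have hg : ∀ n x, f.app n ((he n (e.app n x)).choose) = f.app n x := fun n x => key n _ _ (hs n _)
  refine ⟨⟨fun n => AddMonoidHom.mk' (fun y => f.app n ((he n y).choose)) fun y y' => ?_,
    fun {n k l} hl m a => ?_⟩, GHom.ext fun n x => hg n x⟩
  · rw [← map_add]
    exact key n _ _ (by rw [map_add, hs, hs, hs])
  · show f.app l _ = D.smul hl (f.app n _) a
    rw [← f.app_smul]
    exact key l _ _ (by rw [e.app_smul, hs, hs])

theorem GIso.nonempty_of_ker_eq {A B D : GradedModule P} (e : GHom A B) (he : e.Surj)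
    (f : GHom A D) (hf : f.Surj) (h : ∀ n x, e.app n x = 0 ↔ f.app n x = 0) :
    Nonempty (GIso B D) := by
  obtain ⟨g, hg⟩ := e.exists_desc he f fun n x => (h n x).1
  obtain ⟨g', hg'⟩ := f.exists_desc hf e fun n x => (h n x).2
  refine ⟨⟨g, g', GHom.ext fun n y => ?_, GHom.ext fun n y => ?_⟩⟩
  · obtain ⟨x, rfl⟩ := he n y
    have h₁ := GHom.congr_app hg n x
    have h₂ := GHom.congr_app hg' n x
    simp only [GHom.comp_app, GHom.id_app] at h₁ h₂ ⊢
    rw [h₁, h₂]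
  · obtain ⟨x, rfl⟩ := hf n y
    have h₁ := GHom.congr_app hg n x
    have h₂ := GHom.congr_app hg' n x
    simp only [GHom.comp_app, GHom.id_app] at h₁ h₂ ⊢
    rw [h₂, h₁]

theorem IsProjective.of_retract {Q R : GradedModule P} (hQ : IsProjective Q) (s : GHom R Q)
    (r : GHom Q R) (h : r.comp s = GHom.id R) : IsProjective R := fun A B e he f => by
  obtain ⟨g, hg⟩ := hQ A B e he (f.comp r)
  refine ⟨g.comp s, GHom.ext fun n x => ?_⟩
  have h₁ := GHom.congr_app hg n (s.app n x)
  have h₂ := GHom.congr_app h n x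
  simp only [GHom.comp_app, GHom.id_app] at h₁ h₂ ⊢
  rw [h₁, h₂]

theorem IsShortExact.comp_iso {Z E B B' : GradedModule P} {ι : GHom Z E} {ρ : GHom E B}
    (h : IsShortExact ι ρ) (e : GIso B B') : IsShortExact ι (e.hom.comp ρ) where
  mono := h.mono
  epi n := (Function.LeftInverse.surjective (e.hom_inv_app n)).comp (h.epi n)
  exact n x := by
    rw [← h.exact n x, GHom.comp_app]
    refine ⟨fun hx => ?_, fun hx => by rw [hx, map_zero]⟩
    rw [← e.inv_hom_app n (ρ.app n x), hx, map_zero]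

theorem projDimLE.of_iso {d : ℕ} {M M' : GradedModule P} (h : projDimLE d M) (e : GIso M M') :
    projDimLE d M' := by
  cases d with
  | zero => exact IsProjective.of_retract h e.inv e.hom e.inv_hom_id
  | succ d =>
    obtain ⟨F, K, ε, ι, hF, hι, hK⟩ := h
    exact ⟨F, K, e.hom.comp ε, ι, hF, hι.comp_iso e, hK⟩

end GradedModules

section Truncation

variable {P : C} {N : ℕ}

/-- The part of a graded module in the degrees congruent to `i` modulo `N`. -/
def trunc (hsp : Sparse P N) (i : ZMod N) (M : GradedModule P) : GradedModule P where
  M n := {x : M.M n // (n : ZMod N) ≠ i → x = 0}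
  acg n := inferInstanceAs (AddCommGroup
    ({ carrier := {x | (n : ZMod N) ≠ i → x = 0}
       add_mem' := fun ha hb h => by rw [ha h, hb h, add_zero]
       zero_mem' := fun _ => rfl
       neg_mem' := fun ha h => by rw [ha h, neg_zero] } : AddSubgroup (M.M n)))
  smul {n k l} h m a := ⟨M.smul h m.1 a, fun hl => by
    by_cases hn : (n : ZMod N) = i
    · rw [hsp k (fun hk => hl ?_) a, M.smul_zeroₓ]
      rw [← h, Int.cast_add, (ZMod.intCast_zmod_eq_zero_iff_dvd k N).2 hk, add_zero, hn]
    · rw [m.2 hn, M.zero_smulₓ]⟩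
  smul_addₓ h m a b := Subtype.ext (M.smul_addₓ h m.1 a b)
  add_smulₓ h m m' a := Subtype.ext (M.add_smulₓ h m.1 m'.1 a)
  smul_oneₓ m := Subtype.ext (M.smul_oneₓ m.1)
  smul_mulₓ h₁ h₂ h₃ h₄ m a b := Subtype.ext (M.smul_mulₓ h₁ h₂ h₃ h₄ m.1 a b)

theorem inDegrees_trunc (hsp : Sparse P N) (i : ZMod N) (M : GradedModule P) :
    InDegrees N i (trunc hsp i M) := fun _ hn x => Subtype.ext (x.2 hn)

/-- The inclusion of the truncation. -/
def truncIncl (hsp : Sparse P N) (i : ZMod N) (M : GradedModule P) : GHom (trunc hsp i M) M :=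
  ⟨fun _ => AddMonoidHom.mk' (fun x => x.1) fun _ _ => rfl, fun _ _ _ => rfl⟩

@[simp] theorem truncIncl_app (hsp : Sparse P N) (i : ZMod N) (M : GradedModule P) (n : ℤ)
    (x : (trunc hsp i M).M n) : (truncIncl hsp i M).app n x = x.1 := rfl

open Classical in
/-- The projection onto the truncation. -/
noncomputable def truncProj (hsp : Sparse P N) (i : ZMod N) (M : GradedModule P) :
    GHom M (trunc hsp i M) where
  app n := AddMonoidHom.mk'
    (fun x => ⟨if (n : ZMod N) = i then x else 0, fun h => if_neg h⟩) fun x y => Subtype.ext (by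
      show (if (n : ZMod N) = i then x + y else 0) =
        (if (n : ZMod N) = i then x else 0) + if (n : ZMod N) = i then y else 0
      split_ifs <;> simp)
  app_smul {n k l} h m a := Subtype.ext (by
    show (if (l : ZMod N) = i then M.smul h m a else 0) =
      M.smul h (if (n : ZMod N) = i then m else 0) a
    by_cases hk : (N : ℤ) ∣ k
    · have hl : (l : ZMod N) = n := by
        rw [← h, Int.cast_add, (ZMod.intCast_zmod_eq_zero_iff_dvd k N).2 hk, add_zero]
      rw [hl]
      split_ifs
      · rfl
      · rw [M.zero_smulₓ]
    · rw [hsp k hk a, M.smul_zeroₓ, M.smul_zeroₓ, ite_self])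

theorem truncProj_comp_truncIncl (hsp : Sparse P N) (i : ZMod N) (M : GradedModule P) :
    (truncProj hsp i M).comp (truncIncl hsp i M) = GHom.id _ := GHom.ext fun n x => Subtype.ext (by
  show (if (n : ZMod N) = i then x.1 else 0) = x.1
  split_ifs with h
  · rfl
  · exact (x.2 h).symm)

/-- The morphism induced on truncations. -/
def truncMap (hsp : Sparse P N) (i : ZMod N) {A B : GradedModule P} (f : GHom A B) :
    GHom (trunc hsp i A) (trunc hsp i B) where
  app n := AddMonoidHom.mk' (fun x => ⟨f.app n x.1, fun h => by rw [x.2 h, map_zero]⟩)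
    fun x y => Subtype.ext (map_add (f.app n) x.1 y.1)
  app_smul h m a := Subtype.ext (f.app_smul h m.1 a)

theorem IsShortExact.trunc (hsp : Sparse P N) (i : ZMod N) {Z E B : GradedModule P} {ι : GHom Z E}
    {ρ : GHom E B} (h : IsShortExact ι ρ) :
    IsShortExact (truncMap hsp i ι) (truncMap hsp i ρ) where
  mono n x y hxy := Subtype.ext (h.mono n (congrArg Subtype.val hxy))
  epi n y := by
    by_cases hn : (n : ZMod N) = i
    · obtain ⟨x, hx⟩ := h.epi n y.1
      exact ⟨⟨x, fun h => (h hn).elim⟩, Subtype.ext hx⟩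
    · exact ⟨0, by rw [map_zero, inDegrees_trunc hsp i B n hn y]⟩
  exact n x := by
    refine Subtype.ext_iff.trans ((h.exact n x.1).trans ⟨?_, ?_⟩)
    · rintro ⟨z, hz⟩
      exact ⟨⟨z, fun hn => h.mono n (by rw [hz, map_zero, x.2 hn])⟩, Subtype.ext hz⟩
    · rintro ⟨z, rfl⟩
      exact ⟨z.1, rfl⟩

theorem IsProjective.trunc (hsp : Sparse P N) (i : ZMod N) {M : GradedModule P}
    (h : IsProjective M) : IsProjective (trunc hsp i M) :=
  h.of_retract _ _ (truncProj_comp_truncIncl hsp i M)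

theorem projDimLE.trunc (hsp : Sparse P N) (i : ZMod N) {d : ℕ} {M : GradedModule P}
    (h : projDimLE d M) : projDimLE d (trunc hsp i M) := by
  induction d generalizing M with
  | zero => exact IsProjective.trunc hsp i h
  | succ d ih =>
    obtain ⟨F, K, ε, ι, hF, hι, hK⟩ := h
    exact ⟨_, _, truncMap hsp i ε, truncMap hsp i ι, hF.trunc hsp i, hι.trunc hsp i, ih hK⟩

/-- A module in `B[i]` is isomorphic to its truncation. -/
def InDegrees.truncIso (hsp : Sparse P N) {i : ZMod N} {M : GradedModule P}
    (hM : InDegrees N i M) : GIso (Franke.trunc hsp i M) M where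
  hom := truncIncl hsp i M
  inv :=
    { app := fun n => AddMonoidHom.mk' (fun x => ⟨x, fun h => hM n h x⟩) fun _ _ => rfl
      app_smul := fun _ _ _ => rfl }
  hom_inv_id := rfl
  inv_hom_id := rfl

/-- A module in `B[i]` of projective dimension at most `d + 1` has a resolution step inside
`B[i]`. -/
theorem projDimLE.exists_inDegrees (hsp : Sparse P N) {i : ZMod N} {d : ℕ} {M : GradedModule P}
    (h : projDimLE (d + 1) M) (hM : InDegrees N i M) :
    ∃ (F K : GradedModule P) (ε : GHom F M) (ι : GHom K F), IsProjective F ∧ InDegrees N i F ∧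
      IsShortExact ι ε ∧ InDegrees N i K ∧ projDimLE d K := by
  obtain ⟨F, K, ε, ι, hF, hι, hK⟩ := h
  exact ⟨_, _, _, _, hF.trunc hsp i, inDegrees_trunc hsp i F,
    (hι.trunc hsp i).comp_iso (hM.truncIso hsp), inDegrees_trunc hsp i K, hK.trunc hsp i⟩

end Truncation


section Shift

variable {P : C}

/-- Every element of `π_l (P⟦n⟧)` is a multiple of the identity of `P⟦n⟧`. -/
theorem gsmulHom_id_bijective (P : C) {n k l : ℤ} (h : n + k = l) :
    Function.Bijective (fun a : lam P k => gsmulHom P h (𝟙 (P⟦n⟧)) a) := by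
  constructor
  · intro a b hab
    simp only [gsmulHom, Category.comp_id] at hab
    exact (shiftFunctor C n).map_injective ((cancel_epi _).1 hab)
  · intro x
    refine ⟨(shiftFunctor C n).preimage ((shiftFunctorAdd' C k n l (by omega)).inv.app P ≫ x), ?_⟩
    simp [gsmulHom]

/-- `π_* (P⟦n⟧)` is free on the identity of `P⟦n⟧`: existence of morphisms. -/
theorem exists_gHom_piMod_shift (M : GradedModule P) (n : ℤ) (m : M.M n) :
    ∃ φ : GHom (piMod P (P⟦n⟧)) M, φ.app n (𝟙 (P⟦n⟧)) = m := by
  have hk : ∀ l : ℤ, n + (l - n) = l := fun l => by omega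
  let A : ∀ l, lam P (l - n) ≃ (P⟦l⟧ ⟶ P⟦n⟧) := fun l =>
    Equiv.ofBijective _ (gsmulHom_id_bijective P (hk l))
  have key : ∀ {k l : ℤ} (h : n + k = l) (a : lam P k),
      M.smul (hk l) m ((A l).symm (gsmulHom P h (𝟙 (P⟦n⟧)) a)) = M.smul h m a := by
    intro k l h a
    obtain rfl : k = l - n := by omega
    congr 1
    exact (A l).symm_apply_apply a
  refine ⟨⟨fun l => AddMonoidHom.mk' (fun x => M.smul (hk l) m ((A l).symm x)) fun x y => ?_,
    fun {l k l'} h x a => ?_⟩, ?_⟩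
  · obtain ⟨a, rfl⟩ := (A l).surjective x
    obtain ⟨b, rfl⟩ := (A l).surjective y
    rw [← M.smul_addₓ, (A l).symm_apply_apply, (A l).symm_apply_apply]
    congr 1
    rw [Equiv.symm_apply_eq]
    exact ((piMod P (P⟦n⟧)).smul_addₓ (hk l) (𝟙 (P⟦n⟧)) a b).symm
  · obtain ⟨b, rfl⟩ := (A l).surjective x
    show M.smul (hk l') m ((A l').symm (gsmulHom P h (A l b) a)) =
      M.smul h (M.smul (hk l) m ((A l).symm (A l b))) a
    have e : gsmulHom P h (A l b) a = gsmulHom P (show n + (l' - n) = l' by omega) (𝟙 (P⟦n⟧))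
        (gmul P (show l - n + k = l' - n by omega) b a) :=
      (piMod P (P⟦n⟧)).smul_mulₓ (hk l) (by omega) h (by omega) (𝟙 (P⟦n⟧)) b a
    rw [e, key, (A l).symm_apply_apply]
    exact (M.smul_mulₓ _ _ _ _ m b a).symm
  · show M.smul (hk n) m ((A n).symm (𝟙 (P⟦n⟧))) = m
    have e : 𝟙 (P⟦n⟧) = gsmulHom P (add_zero n) (𝟙 (P⟦n⟧)) (gone P) :=
      ((piMod P (P⟦n⟧)).smul_oneₓ (𝟙 (P⟦n⟧))).symm
    rw [e, key]
    exact M.smul_oneₓ m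

/-- `π_* (P⟦n⟧)` is free on the identity of `P⟦n⟧`: uniqueness of morphisms. -/
theorem gHom_piMod_shift_ext {M : GradedModule P} {n : ℤ} {φ ψ : GHom (piMod P (P⟦n⟧)) M}
    (h : φ.app n (𝟙 (P⟦n⟧)) = ψ.app n (𝟙 (P⟦n⟧))) : φ = ψ := GHom.ext fun l x => by
  have hl : n + (l - n) = l := by omega
  obtain ⟨a, rfl⟩ := (gsmulHom_id_bijective P hl).2 x
  exact (φ.app_smul hl _ a).trans ((congrArg (fun y => M.smul hl y a) h).trans
    (ψ.app_smul hl _ a).symm)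

/-- A morphism out of `P⟦n⟧` into a shift is a shifted morphism. -/
theorem exists_unshift {X : C} {n m l : ℤ} (h : m + l = n) (u : P⟦n⟧ ⟶ X⟦l⟧) :
    ∃ v : P⟦m⟧ ⟶ X, u = (shiftFunctorAdd' C m l n h).hom.app P ≫ v⟦l⟧' :=
  ⟨(shiftFunctor C l).preimage ((shiftFunctorAdd' C m l n h).inv.app P ≫ u), by simp⟩

theorem inDegrees_shift {N : ℕ} {i : ZMod N} {X : C} (hX : InDegrees N i (piMod P X)) (l : ℤ) :
    InDegrees N (i + l) (piMod P (X⟦l⟧)) := fun n hn u => by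
  obtain ⟨v, rfl⟩ := exists_unshift (show n - l + l = n by omega) u
  rw [hX (n - l) (fun h => hn (by rw [← h]; push_cast; ring)) v]
  simp

end Shift

section Coproducts

variable [HasCoproducts.{v} C] {P : C}

theorem compactComparison_of (ι : Type v) [DecidableEq ι] (X : ι → C) (j : ι) (y : P ⟶ X j) :
    compactComparison P X (DirectSum.of (fun j => P ⟶ X j) j y) = y ≫ Sigma.ι X j := by
  unfold compactComparison
  convert DirectSum.toAddMonoid_of (β := fun j => P ⟶ X j) (fun i => AddMonoidHom.mk'
    (fun f => f ≫ Sigma.ι X i) (fun f g => Preadditive.add_comp _ _ _ _ _ _)) j y using 3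
  rfl

/-- Maps from a shift of a compact object into a coproduct, by adjunction. -/
theorem exists_shift_coproduct_equiv (P : C) {ι : Type v} (X : ι → C) (n : ℤ) :
    ∃ (Θ : (P⟦n⟧ ⟶ ∐ X) ≃+ (P ⟶ ∐ fun j => (X j)⟦-n⟧))
      (θ : ∀ j, (P⟦n⟧ ⟶ X j) ≃+ (P ⟶ (X j)⟦-n⟧)),
      ∀ j y, Θ (y ≫ Sigma.ι X j) = θ j y ≫ Sigma.ι (fun j => (X j)⟦-n⟧) j := by
  let adj : shiftFunctor C n ⊣ shiftFunctor C (-n) := (shiftEquiv C n).toAdjunction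
  have hadd : ∀ {Z : C} (f g : P⟦n⟧ ⟶ Z),
      adj.homEquiv P Z (f + g) = adj.homEquiv P Z f + adj.homEquiv P Z g := fun f g => by
    simp [Adjunction.homEquiv_unit]
  let θ : ∀ Z : C, (P⟦n⟧ ⟶ Z) ≃+ (P ⟶ Z⟦-n⟧) := fun Z => ⟨adj.homEquiv P Z, hadd⟩
  let κ : (P ⟶ (∐ X)⟦-n⟧) ≃+ (P ⟶ ∐ fun j => (X j)⟦-n⟧) :=
    { (PreservesCoproduct.iso (shiftFunctor C (-n)) X).homToEquiv with
      map_add' := fun f g => Preadditive.add_comp _ _ _ _ _ _ }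
  refine ⟨(θ _).trans κ, fun j => θ _, fun j y => ?_⟩
  show adj.homEquiv P _ (y ≫ Sigma.ι X j) ≫
    (PreservesCoproduct.iso (shiftFunctor C (-n)) X).hom = adj.homEquiv P _ y ≫ _
  rw [adj.homEquiv_naturality_right, Category.assoc]
  congr 1
  rw [← Iso.eq_comp_inv, PreservesCoproduct.inv_hom, ι_comp_sigmaComparison]

/-- The maps from `P⟦n⟧` into a coproduct are generated by the maps into the summands. -/
theorem IsCompactObj.induction (hP : IsCompactObj P) {ι : Type v} (X : ι → C) (n : ℤ)
    {p : (P⟦n⟧ ⟶ ∐ X) → Prop} (zero : p 0) (of : ∀ j (y : P⟦n⟧ ⟶ X j), p (y ≫ Sigma.ι X j))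
    (add : ∀ x y, p x → p y → p (x + y)) (x : P⟦n⟧ ⟶ ∐ X) : p x := by
  classical
  obtain ⟨Θ, θ, h⟩ := exists_shift_coproduct_equiv P X n
  obtain ⟨z, hz⟩ := (hP ι fun j => (X j)⟦-n⟧).2 (Θ x)
  obtain rfl : x = Θ.symm (compactComparison P _ z) := by rw [hz, Θ.symm_apply_apply]
  clear hz
  induction z using DirectSum.induction_on with
  | zero => simpa using zero
  | of j y =>
    obtain ⟨y, rfl⟩ := (θ j).surjective y
    rw [compactComparison_of, ← h, Θ.symm_apply_apply]
    exact of j y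
  | add a b ha hb =>
    rw [map_add, map_add]
    exact add _ _ ha hb

/-- Additive maps out of `Hom(P⟦n⟧, ∐ X)` may be prescribed on the summands. -/
theorem IsCompactObj.exists_addMonoidHom (hP : IsCompactObj P) {ι : Type v} (X : ι → C) (n : ℤ)
    {A : Type v} [AddCommGroup A] (φ : ∀ j, (P⟦n⟧ ⟶ X j) →+ A) :
    ∃ Φ : (P⟦n⟧ ⟶ ∐ X) →+ A, ∀ j y, Φ (y ≫ Sigma.ι X j) = φ j y := by
  classical
  obtain ⟨Θ, θ, h⟩ := exists_shift_coproduct_equiv P X n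
  let κ := AddEquiv.ofBijective _ (hP ι fun j => (X j)⟦-n⟧)
  refine ⟨((DirectSum.toAddMonoid fun j => (φ j).comp (θ j).symm.toAddMonoidHom).comp
    κ.symm.toAddMonoidHom).comp Θ.toAddMonoidHom, fun j y => ?_⟩
  have e : κ.symm (Θ (y ≫ Sigma.ι X j)) = DirectSum.of (fun j => P ⟶ (X j)⟦-n⟧) j (θ j y) := by
    rw [AddEquiv.symm_apply_eq, h]
    exact (compactComparison_of ι (fun j => (X j)⟦-n⟧) j (θ j y)).symm
  show DirectSum.toAddMonoid _ (κ.symm (Θ (y ≫ Sigma.ι X j))) = _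
  rw [e, DirectSum.toAddMonoid_of]
  simp

/-- `π_*` of a coproduct is a coproduct: existence of morphisms. -/
theorem IsCompactObj.exists_gHom_desc (hP : IsCompactObj P) {ι : Type v} (X : ι → C)
    {M : GradedModule P} (φ : ∀ j, GHom (piMod P (X j)) M) :
    ∃ Φ : GHom (piMod P (∐ X)) M, ∀ j, Φ.comp (piGHom P (Sigma.ι X j)) = φ j := by
  choose Φ hΦ using fun n => hP.exists_addMonoidHom X n fun j => (φ j).app n
  refine ⟨⟨Φ, fun {n k l} h x a => ?_⟩, fun j => GHom.ext fun n y => hΦ n j y⟩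
  induction x using hP.induction with
  | zero =>
    have e : (piMod P (∐ X)).smul h 0 a = 0 := (piMod P (∐ X)).zero_smulₓ h a
    rw [e, map_zero, map_zero, M.zero_smulₓ]
  | of j y =>
    have e : (piMod P (∐ X)).smul h (y ≫ Sigma.ι X j) a = gsmulHom P h y a ≫ Sigma.ι X j := by
      simp [gsmulHom]
    rw [e, hΦ, hΦ]
    exact (φ j).app_smul h y a
  | add x y hx hy =>
    have e := (piMod P (∐ X)).add_smulₓ h x y a
    rw [e, map_add, map_add, M.add_smulₓ, hx, hy]

/-- `π_*` of a coproduct is a coproduct: uniqueness of morphisms. -/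
theorem IsCompactObj.gHom_ext (hP : IsCompactObj P) {ι : Type v} (X : ι → C)
    {M : GradedModule P} {Φ Ψ : GHom (piMod P (∐ X)) M}
    (h : ∀ j, Φ.comp (piGHom P (Sigma.ι X j)) = Ψ.comp (piGHom P (Sigma.ι X j))) : Φ = Ψ :=
  GHom.ext fun n x => by
    induction x using hP.induction with
    | zero => rw [map_zero, map_zero]
    | of j y => exact GHom.congr_app (h j) n y
    | add x y hx hy => rw [map_add, map_add, hx, hy]

end Coproducts


section Splitting

variable [HasCoproducts.{v} C]

/-- Idempotents split in a triangulated category with coproducts. -/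
theorem exists_splitting {F : C} (p : F ⟶ F) (hp : p ≫ p = p) :
    ∃ (X : C) (a : F ⟶ X) (b : X ⟶ F), a ≫ b = p ∧ b ≫ a = 𝟙 X := by
  let S : C := ∐ fun _ : ULift.{v} ℕ => F
  let inc : ℕ → (F ⟶ S) := fun k => Sigma.ι (fun _ : ULift.{v} ℕ => F) ⟨k⟩
  have ext : ∀ {Z : C} {f g : S ⟶ Z}, (∀ k, inc k ≫ f = inc k ≫ g) → f = g := fun h =>
    Sigma.hom_ext _ _ fun k => h k.down
  have desc : ∀ {Z : C} (f : ℕ → (F ⟶ Z)), ∃ g : S ⟶ Z, ∀ k, inc k ≫ g = f k := fun f =>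
    ⟨Sigma.desc fun k => f k.down, fun k => by simp [inc]⟩
  obtain ⟨t, ht⟩ := desc fun k => inc k - p ≫ inc (k + 1)
  obtain ⟨r, hr⟩ := desc fun k => inc k - ∑ m ∈ Finset.range (k + 1), p ≫ inc m
  obtain ⟨fold, hfold⟩ := desc fun _ => 𝟙 F
  have tr : t ≫ r = 𝟙 S := ext fun k => by
    rw [← Category.assoc, ht, Preadditive.sub_comp, Category.assoc, hr, hr,
      Preadditive.comp_sub, Preadditive.comp_sum, Finset.sum_range_succ _ (k + 1)]
    simp only [← Category.assoc, hp, Category.comp_id]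
    abel
  have rt : r ≫ t = 𝟙 S - fold ≫ p ≫ inc 0 := ext fun k => by
    have e : ∀ n, ∑ m ∈ Finset.range n, (p ≫ inc m - p ≫ inc (m + 1)) = p ≫ inc 0 - p ≫ inc n :=
      fun n => Finset.sum_range_sub' (fun m => p ≫ inc m) n
    rw [← Category.assoc, hr, Preadditive.sub_comp, Preadditive.sum_comp, ht,
      Preadditive.comp_sub, Category.comp_id, ← Category.assoc, hfold, Category.id_comp]
    simp only [Category.assoc, ht, Preadditive.comp_sub]
    simp only [← Category.assoc, hp]
    rw [e]
    abel
  obtain ⟨X, q, h, hT⟩ := distinguished_cocone_triangle t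
  have htq : t ≫ q = 0 := comp_distTriang_mor_zero₁₂ _ hT
  have hq : Epi q := Triangle.epi₂ _ hT (by
    rw [Triangle.mor₃_eq_zero_iff_mono₁ _ hT]
    exact (SplitMono.mk r tr).mono)
  have hfq : fold ≫ p ≫ inc 0 ≫ q = q := by
    have e : r ≫ t ≫ q = 0 := by rw [htq, comp_zero]
    rw [← Category.assoc, rt, Preadditive.sub_comp, Category.id_comp, sub_eq_zero] at e
    simpa using e.symm
  obtain ⟨b, hb⟩ : ∃ b : X ⟶ F, fold ≫ p = q ≫ b :=
    Triangle.yoneda_exact₂ _ hT (fold ≫ p) (ext fun k => by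
      show inc k ≫ t ≫ fold ≫ p = inc k ≫ 0
      rw [← Category.assoc, ht, Preadditive.sub_comp, comp_zero]
      simp only [← Category.assoc, hfold, Category.id_comp]
      rw [Category.assoc, Category.assoc, ← Category.assoc (inc (k + 1)), hfold]
      simp [hp])
  refine ⟨X, p ≫ inc 0 ≫ q, b, ?_, ?_⟩
  · rw [Category.assoc, Category.assoc, ← hb, ← Category.assoc (inc 0), hfold, Category.id_comp, hp]
  · rw [← cancel_epi q, ← Category.assoc, ← hb, Category.assoc, ← Category.assoc p, hp, hfq,
      Category.comp_id]

end Splitting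

section Realization

variable {P : C}

theorem piGHom_comp {X Y Z : C} (f : X ⟶ Y) (g : Y ⟶ Z) :
    piGHom P (f ≫ g) = (piGHom P g).comp (piGHom P f) :=
  GHom.ext fun _ _ => (Category.assoc _ _ _).symm

theorem piGHom_id (X : C) : piGHom P (𝟙 X) = GHom.id (piMod P X) :=
  GHom.ext fun _ _ => Category.comp_id _

theorem GHom.comp_assoc {A B D E : GradedModule P} (f : GHom A B) (g : GHom B D) (h : GHom D E) :
    (h.comp g).comp f = h.comp (g.comp f) := rfl

theorem GHom.comp_id {A B : GradedModule P} (f : GHom A B) : f.comp (GHom.id A) = f := rfl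

theorem GHom.id_comp {A B : GradedModule P} (f : GHom A B) : (GHom.id B).comp f = f := rfl

/-- `X` is `π_*`-free if `π_*` is bijective on all morphisms out of `X`. -/
def PiFree (P X : C) : Prop :=
  ∀ Y : C, Function.Bijective (fun f : X ⟶ Y => piGHom P f)

theorem PiFree.of_retract {X Z : C} (hX : PiFree P X) (s : Z ⟶ X) (r : X ⟶ Z)
    (h : s ≫ r = 𝟙 Z) : PiFree P Z := fun Y => by
  constructor
  · intro f g hfg
    have e : r ≫ f = r ≫ g := (hX Y).1 (by
      show piGHom P _ = piGHom P _
      rw [piGHom_comp, piGHom_comp]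
      exact congrArg (fun φ => GHom.comp φ (piGHom P r)) hfg)
    rw [← Category.id_comp f, ← h, Category.assoc, e, ← Category.assoc, h, Category.id_comp]
  · intro φ
    obtain ⟨f, hf⟩ := (hX Y).2 (φ.comp (piGHom P r))
    refine ⟨s ≫ f, ?_⟩
    show piGHom P _ = _
    rw [piGHom_comp, show piGHom P f = _ from hf, GHom.comp_assoc, ← piGHom_comp, h, piGHom_id,
      GHom.comp_id]

theorem piFree_shift (P : C) (n : ℤ) : PiFree P (P⟦n⟧) := fun Y => by
  constructor
  · intro f g hfg
    have e : 𝟙 (P⟦n⟧) ≫ f = 𝟙 (P⟦n⟧) ≫ g := GHom.congr_app hfg n (𝟙 (P⟦n⟧))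
    simpa using e
  · intro φ
    exact ⟨φ.app n (𝟙 _), gHom_piMod_shift_ext (Category.id_comp _)⟩

theorem PiFree.coproduct [HasCoproducts.{v} C] (hP : IsCompactObj P) {ι : Type v} (X : ι → C)
    (hX : ∀ j, PiFree P (X j)) : PiFree P (∐ X) := fun Y => by
  constructor
  · intro f g hfg
    refine Sigma.hom_ext _ _ fun j => (hX j Y).1 ?_
    show piGHom P _ = piGHom P _
    rw [piGHom_comp, piGHom_comp]
    exact congrArg (fun φ => GHom.comp φ _) hfg
  · intro φ
    choose f hf using fun j => (hX j Y).2 (φ.comp (piGHom P (Sigma.ι X j)))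
    refine ⟨Sigma.desc f, hP.gHom_ext X fun j => ?_⟩
    rw [← hf j, ← piGHom_comp]
    simp

/-- Every graded module is a quotient of `π_*` of a `π_*`-free object. -/
theorem exists_piFree_cover [HasCoproducts.{v} C] (hP : IsCompactObj P) (M : GradedModule P) :
    ∃ (F : C) (e : GHom (piMod P F) M), PiFree P F ∧ e.Surj := by
  choose φ hφ using fun j : Σ n : ℤ, M.M n => exists_gHom_piMod_shift M j.1 j.2
  obtain ⟨Φ, hΦ⟩ := hP.exists_gHom_desc (fun j : Σ n : ℤ, M.M n => P⟦j.1⟧) φ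
  refine ⟨_, Φ, PiFree.coproduct hP _ fun j => piFree_shift P j.1, fun n m => ?_⟩
  exact ⟨_, (GHom.congr_app (hΦ ⟨n, m⟩) n (𝟙 _)).trans (hφ ⟨n, m⟩)⟩

/-- Every projective graded module is `π_*` of a `π_*`-free object. -/
theorem IsProjective.exists_piFree [HasCoproducts.{v} C] (hP : IsCompactObj P)
    {Q : GradedModule P} (hQ : IsProjective Q) :
    ∃ X : C, PiFree P X ∧ Nonempty (GIso (piMod P X) Q) := by
  obtain ⟨F, e, hF, he⟩ := exists_piFree_cover hP Q
  obtain ⟨s, hs⟩ := hQ _ _ e he (GHom.id Q)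
  obtain ⟨p, hp⟩ := (hF F).2 (s.comp e)
  have hp : piGHom P p = s.comp e := hp
  have hpp : p ≫ p = p := (hF F).1 (by
    show piGHom P _ = piGHom P _
    rw [piGHom_comp, hp, GHom.comp_assoc, ← GHom.comp_assoc e, hs, GHom.id_comp])
  obtain ⟨X, a, b, hab, hba⟩ := exists_splitting p hpp
  refine ⟨X, hF.of_retract b a hba, ⟨⟨e.comp (piGHom P b), (piGHom P a).comp s, ?_, ?_⟩⟩⟩
  · calc ((piGHom P a).comp s).comp (e.comp (piGHom P b))
        = (piGHom P a).comp ((s.comp e).comp (piGHom P b)) := rfl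
      _ = piGHom P ((b ≫ a) ≫ (b ≫ a)) := by
        rw [← hp, ← hab, ← piGHom_comp, ← piGHom_comp]
        simp
      _ = GHom.id _ := by rw [hba, Category.comp_id, piGHom_id]
  · calc (e.comp (piGHom P b)).comp ((piGHom P a).comp s)
        = e.comp (((piGHom P b).comp (piGHom P a)).comp s) := rfl
      _ = (e.comp s).comp (e.comp s) := by rw [← piGHom_comp, hab, hp]; rfl
      _ = GHom.id _ := by rw [hs]; rfl

theorem injective_shift_map_of_injective {X Y : C} (f : X ⟶ Y)
    (hf : ∀ n : ℤ, Function.Injective ((piGHom P f).app n)) {n : ℤ} {u : P⟦n⟧ ⟶ X⟦(1 : ℤ)⟧}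
    (hu : u ≫ f⟦(1 : ℤ)⟧' = 0) : u = 0 := by
  obtain ⟨v, rfl⟩ := exists_unshift (show n - 1 + 1 = n by omega) u
  rw [Category.assoc, ← Functor.map_comp] at hu
  have e : v ≫ f = 0 := (shiftFunctor C (1 : ℤ)).map_injective (by
    rw [Functor.map_zero, ← cancel_epi ((shiftFunctorAdd' C (n - 1) 1 n (by omega)).hom.app P),
      comp_zero]
    exact hu)
  rw [show v = 0 from hf (n - 1) (by rw [map_zero]; exact e), Functor.map_zero, comp_zero]

/-- A morphism inducing bijections on `π_*` is an isomorphism. -/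
theorem IsGenerator.isIso (hP : IsGenerator P) {X Y : C} (f : X ⟶ Y)
    (hf : ∀ n : ℤ, Function.Bijective ((piGHom P f).app n)) : IsIso f := by
  obtain ⟨Z, g, h, hT⟩ := distinguished_cocone_triangle f
  refine (Triangle.isZero₃_iff_isIso₁ _ hT).1 (hP Z fun n z => ?_)
  have hz : z ≫ h = 0 := injective_shift_map_of_injective f (fun n => (hf n).1) (by
    rw [Category.assoc, show h ≫ f⟦(1 : ℤ)⟧' = 0 from comp_distTriang_mor_zero₃₁ _ hT, comp_zero])
  obtain ⟨y, hy⟩ := Triangle.coyoneda_exact₃ _ hT z hz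
  obtain ⟨x, rfl⟩ := (hf n).2 y
  rw [hy]
  show (x ≫ f) ≫ g = 0
  rw [Category.assoc, show f ≫ g = 0 from comp_distTriang_mor_zero₁₂ _ hT, comp_zero]

/-- An object with projective `π_*` is `π_*`-free. -/
theorem IsProjective.piFree [HasCoproducts.{v} C] (hP : IsCompactObj P) (hgen : IsGenerator P)
    {X : C} (hX : IsProjective (piMod P X)) : PiFree P X := by
  obtain ⟨X', hX', ⟨e⟩⟩ := hX.exists_piFree hP
  obtain ⟨f, hf⟩ := (hX' X).2 e.hom
  have : IsIso f := hgen.isIso f fun n => by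
    rw [show piGHom P f = e.hom from hf]
    exact ⟨Function.LeftInverse.injective (e.inv_hom_app n),
      Function.LeftInverse.surjective (e.hom_inv_app n)⟩
  exact hX'.of_retract (inv f) f (by simp)

end Realization

section FullyFaithful

variable [HasCoproducts.{v} C] {P : C} {N : ℕ}

/-- A triangle whose first map is injective on `π_*` induces a short exact sequence. -/
theorem isShortExact_of_injective {X Y Z : C} {f : X ⟶ Y} {g : Y ⟶ Z} {h : Z ⟶ X⟦(1 : ℤ)⟧}
    (hT : Triangle.mk f g h ∈ distTriang C)
    (hf : ∀ n : ℤ, Function.Injective ((piGHom P f).app n)) :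
    IsShortExact (piGHom P f) (piGHom P g) where
  mono := hf
  epi n z := by
    obtain ⟨y, hy⟩ := Triangle.coyoneda_exact₃ _ hT z
      (injective_shift_map_of_injective f hf (by
        refine (Category.assoc z h _).trans ?_
        rw [show h ≫ f⟦(1 : ℤ)⟧' = 0 from comp_distTriang_mor_zero₃₁ _ hT, comp_zero]))
    exact ⟨y, hy.symm⟩
  exact n y := by
    constructor
    · intro hy
      obtain ⟨x, hx⟩ := Triangle.coyoneda_exact₂ _ hT y hy
      exact ⟨x, hx.symm⟩
    · rintro ⟨x, rfl⟩
      show (x ≫ f) ≫ g = 0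
      rw [Category.assoc, show f ≫ g = 0 from comp_distTriang_mor_zero₁₂ _ hT, comp_zero]

/-- A triangle whose second map is surjective on `π_*` has first map injective on `π_*`. -/
theorem injective_of_surj {X Y Z : C} {f : X ⟶ Y} {g : Y ⟶ Z} {h : Z ⟶ X⟦(1 : ℤ)⟧}
    (hT : Triangle.mk f g h ∈ distTriang C) (hg : (piGHom P g).Surj) (n : ℤ) :
    Function.Injective ((piGHom P f).app n) := by
  rw [injective_iff_map_eq_zero]
  intro x hx
  have hx : x ≫ f = 0 := hx
  let s := (shiftFunctorAdd' C n 1 (n + 1) rfl).hom.app P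
  have e : (s ≫ x⟦(1 : ℤ)⟧') ≫ f⟦(1 : ℤ)⟧' = 0 := by
    rw [Category.assoc, ← Functor.map_comp, hx, Functor.map_zero, comp_zero]
  obtain ⟨z, hz⟩ := Triangle.coyoneda_exact₁ _ hT _ e
  obtain ⟨y, rfl⟩ := hg (n + 1) z
  have e' : s ≫ x⟦(1 : ℤ)⟧' = 0 := by
    rw [hz]
    show (y ≫ g) ≫ h = 0
    rw [Category.assoc, show g ≫ h = 0 from comp_distTriang_mor_zero₂₃ _ hT, comp_zero]
  refine (shiftFunctor C (1 : ℤ)).map_injective ?_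
  rw [Functor.map_zero, ← cancel_epi s, e', comp_zero]

/-- A topological resolution step inside `E_i`. -/
theorem projDimLE.exists_triangle (hP : IsCompactObj P) (hsp : Sparse P N) {i : ZMod N} {d : ℕ}
    {X : C} (hX : InDegrees N i (piMod P X)) (hd : projDimLE (d + 1) (piMod P X)) :
    ∃ (K F : C) (f : K ⟶ F) (g : F ⟶ X) (h : X ⟶ K⟦(1 : ℤ)⟧),
      Triangle.mk f g h ∈ distTriang C ∧ PiFree P F ∧ (piGHom P g).Surj ∧
      InDegrees N i (piMod P K) ∧ projDimLE d (piMod P K) := by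
  obtain ⟨F', K', ε, ι, hF', hF'i, hι, hK'i, hK'⟩ := hd.exists_inDegrees hsp hX
  obtain ⟨F, hF, ⟨e⟩⟩ := hF'.exists_piFree hP
  obtain ⟨g, hg⟩ := (hF X).2 (ε.comp e.hom)
  have hg : piGHom P g = ε.comp e.hom := hg
  have hgs : (piGHom P g).Surj := fun n => by
    rw [hg]
    exact (hι.epi n).comp (Function.LeftInverse.surjective (e.hom_inv_app n))
  obtain ⟨K, f, h, hT⟩ := distinguished_cocone_triangle₁ g
  have hf := injective_of_surj hT hgs
  have hse := isShortExact_of_injective hT hf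
  obtain ⟨eK⟩ : Nonempty (GIso K' (piMod P K)) := by
    have hker : ∀ n z, (piGHom P g).app n ((e.inv.comp ι).app n z) = 0 := fun n z => by
      rw [hg, GHom.comp_app, GHom.comp_app, e.hom_inv_app]
      exact (hι.exact n _).2 ⟨z, rfl⟩
    choose a ha using fun n z => (hse.exact n _).1 (hker n z)
    have hinj : ∀ n, Function.Injective ((e.inv.comp ι).app n) := fun n =>
      (Function.LeftInverse.injective (e.hom_inv_app n)).comp (hι.mono n)
    let A : GHom K' (piMod P K) :=
      ⟨fun n => AddMonoidHom.mk' (a n) fun z z' => hf n (by rw [map_add, ha, ha, ha, map_add]),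
        fun {n k l} hl z b => hf l (by
          rw [(piGHom P f).app_smul]
          show (piGHom P f).app l (a l _) = (piMod P F).smul hl ((piGHom P f).app n (a n z)) b
          rw [ha, ha, (e.inv.comp ι).app_smul])⟩
    refine GIso.nonempty_of_ker_eq (GHom.id K') (fun n => Function.surjective_id) A
      (fun n y => ?_) fun n z => ?_
    · have hy : ε.app n (e.hom.app n ((piGHom P f).app n y)) = 0 := by
        rw [← GHom.comp_app, ← hg]
        exact (hse.exact n _).2 ⟨y, rfl⟩
      obtain ⟨z, hz⟩ := (hι.exact n _).1 hy
      refine ⟨z, hf n ((ha n z).trans ?_)⟩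
      rw [GHom.comp_app, hz, e.inv_hom_app]
    · refine ⟨fun hz => ?_, fun hz => hinj n ?_⟩
      · rw [show z = 0 from hz, map_zero]
      · rw [map_zero, GHom.id_app, ← ha, show a n z = 0 from hz, map_zero]
  exact ⟨K, F, f, g, h, hT, hF, hgs, hK'i.of_iso eK, hK'.of_iso eK⟩

/-- Vanishing of morphisms between objects of different degrees. -/
theorem eq_zero_of_projDimLE (hP : IsCompactObj P) (hgen : IsGenerator P) (hsp : Sparse P N)
    {i j : ZMod N} {d : ℕ} {X Y : C} (hX : InDegrees N i (piMod P X))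
    (hd : projDimLE d (piMod P X)) (hY : InDegrees N j (piMod P Y))
    (hij : ∀ k : ℕ, k ≤ d → i + k ≠ j) (f : X ⟶ Y) : f = 0 := by
  have hzero : ∀ {X Y : C}, InDegrees N i (piMod P X) → ∀ {j : ZMod N},
      InDegrees N j (piMod P Y) → i ≠ j → ∀ f : X ⟶ Y, piGHom P f = piGHom P 0 := by
    intro X Y hX j hY hij f
    refine GHom.ext fun n x => ?_
    by_cases hn : (n : ZMod N) = i
    · rw [hY n (hn ▸ hij) ((piGHom P f).app n x), hY n (hn ▸ hij) ((piGHom P 0).app n x)]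
    · rw [hX n hn x, map_zero, map_zero]
  induction d generalizing X Y j with
  | zero =>
    exact (IsProjective.piFree hP hgen hd Y).1
      (hzero hX hY (by simpa using hij 0 le_rfl) f)
  | succ d ih =>
    obtain ⟨K, F, a, g, h, hT, hF, hg, hK, hKd⟩ := hd.exists_triangle hP hsp hX
    have hgf : piGHom P f = piGHom P 0 := hzero hX hY (by simpa using hij 0 (by omega)) f
    have hgf : g ≫ f = 0 := (hF Y).1 (by
      show piGHom P _ = piGHom P _
      rw [piGHom_comp, hgf, ← piGHom_comp, comp_zero])
    obtain ⟨w, rfl⟩ : ∃ w : K⟦(1 : ℤ)⟧ ⟶ Y, f = h ≫ w := Triangle.yoneda_exact₃ _ hT f hgf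
    let adj : shiftFunctor C (1 : ℤ) ⊣ shiftFunctor C (-1 : ℤ) := (shiftEquiv C (1 : ℤ)).toAdjunction
    have hw : w = 0 := (adj.homEquiv K Y).injective (by
      have h₀ := fun u => ih hK hKd (inDegrees_shift hY (-1)) (fun k hk e => hij (k + 1) (by omega)
        (by push_cast; rw [← add_assoc, e]; push_cast; ring)) u
      exact (h₀ _).trans (h₀ _).symm)
    rw [hw, comp_zero]

theorem piGHom_injective (hP : IsCompactObj P) (hgen : IsGenerator P) (hsp : Sparse P N)
    {i : ZMod N} {d : ℕ} (hdN : d < N) {X Y : C} (hX : InDegrees N i (piMod P X))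
    (hd : projDimLE d (piMod P X)) (hY : InDegrees N i (piMod P Y)) :
    Function.Injective (fun f : X ⟶ Y => piGHom P f) := by
  cases d with
  | zero => exact (IsProjective.piFree hP hgen hd Y).1
  | succ d =>
    obtain ⟨K, F, a, g, h, hT, hF, hg, hK, hKd⟩ := hd.exists_triangle hP hsp hX
    intro f₁ f₂ hf
    have hgf : g ≫ (f₁ - f₂) = 0 := by
      rw [Preadditive.comp_sub, sub_eq_zero]
      refine (hF Y).1 ?_
      show piGHom P _ = piGHom P _
      rw [piGHom_comp, piGHom_comp]
      exact congrArg (fun φ => GHom.comp φ (piGHom P g)) hf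
    obtain ⟨w, hw⟩ : ∃ w : K⟦(1 : ℤ)⟧ ⟶ Y, f₁ - f₂ = h ≫ w :=
      Triangle.yoneda_exact₃ _ hT (f₁ - f₂) hgf
    let adj : shiftFunctor C (1 : ℤ) ⊣ shiftFunctor C (-1 : ℤ) := (shiftEquiv C (1 : ℤ)).toAdjunction
    have hw0 : w = 0 := (adj.homEquiv K Y).injective (by
      have h₀ := fun u => eq_zero_of_projDimLE hP hgen hsp hK hKd (inDegrees_shift hY (-1))
        (fun k hk e => by
          have e' : ((k + 1 : ℕ) : ZMod N) = 0 := by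
            have := add_left_cancel e
            push_cast at this ⊢
            rw [this]; ring
          rw [ZMod.natCast_eq_zero_iff] at e'
          exact absurd (Nat.le_of_dvd (by omega) e') (by omega)) u
      exact (h₀ _).trans (h₀ _).symm)
    rw [← sub_eq_zero, hw, hw0, comp_zero]

theorem piGHom_bijective (hP : IsCompactObj P) (hgen : IsGenerator P) (hsp : Sparse P N)
    {i : ZMod N} {d : ℕ} (hdN : d < N) {X Y : C} (hX : InDegrees N i (piMod P X))
    (hd : projDimLE d (piMod P X)) (hY : InDegrees N i (piMod P Y)) :
    Function.Bijective (fun f : X ⟶ Y => piGHom P f) := by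
  refine ⟨piGHom_injective hP hgen hsp hdN hX hd hY, fun φ => ?_⟩
  cases d with
  | zero => exact (IsProjective.piFree hP hgen hd Y).2 φ
  | succ d =>
    obtain ⟨K, F, a, g, h, hT, hF, hg, hK, hKd⟩ := hd.exists_triangle hP hsp hX
    obtain ⟨f, hf⟩ := (hF Y).2 (φ.comp (piGHom P g))
    have hf : piGHom P f = φ.comp (piGHom P g) := hf
    have hag : a ≫ g = 0 := comp_distTriang_mor_zero₁₂ _ hT
    have haf : a ≫ f = 0 := piGHom_injective hP hgen hsp (by omega) hK hKd hY (by
      show piGHom P _ = piGHom P _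
      rw [piGHom_comp, hf, GHom.comp_assoc, ← piGHom_comp, hag]
      refine GHom.ext fun n x => ?_
      show φ.app n ((x : P⟦n⟧ ⟶ K) ≫ (0 : K ⟶ X)) = (x : P⟦n⟧ ⟶ K) ≫ (0 : K ⟶ Y)
      rw [comp_zero, comp_zero]
      exact map_zero _)
    obtain ⟨w, hw⟩ : ∃ w : X ⟶ Y, f = g ≫ w := Triangle.yoneda_exact₂ _ hT f haf
    refine ⟨w, GHom.ext fun n x => ?_⟩
    obtain ⟨x, rfl⟩ := hg n x
    have e := GHom.congr_app hf n x
    rw [hw, piGHom_comp] at e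
    exact e

/-- Modules of `B[i]` of small projective dimension are realized by objects. -/
theorem projDimLE.exists_piMod_iso (hP : IsCompactObj P) (hgen : IsGenerator P) (hsp : Sparse P N)
    {i : ZMod N} {d : ℕ} (hdN : d < N) {M : GradedModule P} (hM : InDegrees N i M)
    (hd : projDimLE d M) : ∃ X : C, Nonempty (GIso (piMod P X) M) := by
  induction d generalizing M with
  | zero =>
    obtain ⟨X, -, e⟩ := IsProjective.exists_piFree hP hd
    exact ⟨X, e⟩
  | succ d ih =>
    obtain ⟨F', K', ε, ι, hF', hF'i, hι, hK'i, hK'⟩ := hd.exists_inDegrees hsp hM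
    obtain ⟨F, hF, ⟨e⟩⟩ := hF'.exists_piFree hP
    obtain ⟨K, ⟨k⟩⟩ := ih (by omega) hK'i hK'
    obtain ⟨f, hf⟩ := (piGHom_bijective hP hgen hsp (by omega) (hK'i.of_iso k.symm)
      (hK'.of_iso k.symm) (hF'i.of_iso e.symm)).2 (e.inv.comp (ι.comp k.hom))
    have hf : piGHom P f = e.inv.comp (ι.comp k.hom) := hf
    have hfinj : ∀ n : ℤ, Function.Injective ((piGHom P f).app n) := fun n => by
      rw [hf]
      exact (Function.LeftInverse.injective (e.hom_inv_app n)).comp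
        ((hι.mono n).comp (Function.LeftInverse.injective (k.inv_hom_app n)))
    obtain ⟨X, g, h, hT⟩ := distinguished_cocone_triangle f
    have hse := isShortExact_of_injective hT hfinj
    refine ⟨X, GIso.nonempty_of_ker_eq (piGHom P g) hse.epi (ε.comp e.hom) (fun n =>
      (hι.epi n).comp (Function.LeftInverse.surjective (e.hom_inv_app n))) fun n x => ?_⟩
    rw [hse.exact n x, GHom.comp_app, hι.exact n, hf]
    constructor
    · rintro ⟨y, rfl⟩
      exact ⟨k.hom.app n y, (e.hom_inv_app n _).symm⟩
    · rintro ⟨z, hz⟩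
      refine ⟨k.inv.app n z, ?_⟩
      rw [GHom.comp_app, GHom.comp_app, k.hom_inv_app, hz, e.inv_hom_app]

end FullyFaithful


/-- Let `P` be a compact generator of the triangulated category `C`,
with `Λ` `N`-sparse and `gl dim Λ < N`. Then `π_*` restricts to an equivalence from the
full subcategory `E_i` of objects with `π_* X ∈ B[i]` onto the full subcategory `B[i]`
of graded right `Λ`-modules concentrated in degrees `≡ i (mod N)`: it is bijective on
hom-sets between objects of `E_i`, and every module in `B[i]` is isomorphic to some
`π_* X` with `X ∈ E_i`. -/
theorem statement_2 [IsTriangulated C] [HasCoproducts.{v} C]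
    (P : C) (hcpt : IsCompactObj P) (hgen : IsGenerator P)
    (N : ℕ) (hN : 2 ≤ N) (hsp : Sparse P N)
    (hgl : ∀ M : GradedModule P, projDimLE (N - 1) M)
    (i : ZMod N) :
    (∀ X Y : C, InDegrees N i (piMod P X) → InDegrees N i (piMod P Y) →
      Function.Bijective (fun f : X ⟶ Y => piGHom P f)) ∧
    (∀ M : GradedModule P, InDegrees N i M →
      ∃ X : C, InDegrees N i (piMod P X) ∧ Nonempty (GIso (piMod P X) M)) := by
  refine ⟨fun X Y hX hY => piGHom_bijective hcpt hgen hsp (by omega : N - 1 < N) hX (hgl _) hY,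
    fun M hM => ?_⟩
  obtain ⟨X, ⟨e⟩⟩ := (hgl M).exists_piMod_iso hcpt hgen hsp (by omega : N - 1 < N) hM
  exact ⟨X, hM.of_iso e.symm, ⟨e⟩⟩

end Franke
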